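/- Full solvability under coercivity (Lions–Papanicolaou–Varadhan): Let H : ℝ^N × ℝ^N → ℝ be continuous, ℤ^N-periodic in its first variable, and coercive. Then for every P ∈ ℝ^N there exist a Lipschitz continuous ℤ^N-periodic function u : ℝ^N → ℝ and a constant a ∈ ℝ such that (u, a) is a solution of the cell problem H(x, Du + P) = a on T^N. -/

import Mathlib

open Set Filter MeasureTheory

noncomputable section

abbrev Euc (N : ℕ) := EuclideanSpace ℝ (Fin N)

def intVec {N : ℕ} (z : Fin N → ℤ) : Euc N :=
  (EuclideanSpace.equiv (Fin N) ℝ).symm (fun i => (z i : ℝ))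

def IsZPeriodic {N : ℕ} (u : Euc N → ℝ) : Prop :=
  ∀ (x : Euc N) (z : Fin N → ℤ), u (x + intVec z) = u x

def IsZPeriodicH {N : ℕ} (H : Euc N → Euc N → ℝ) : Prop :=
  ∀ (x p : Euc N) (z : Fin N → ℤ), H (x + intVec z) p = H x p

def superDiff {N : ℕ} (u : Euc N → ℝ) (x : Euc N) : Set (Euc N) :=
  { q | ∃ φ : Euc N → ℝ, ContDiff ℝ 1 φ ∧ IsZPeriodic φ ∧
        (∀ y, u y - φ y ≤ u x - φ x) ∧ q = gradient φ x }

def subDiff {N : ℕ} (u : Euc N → ℝ) (x : Euc N) : Set (Euc N) :=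
  { q | ∃ φ : Euc N → ℝ, ContDiff ℝ 1 φ ∧ IsZPeriodic φ ∧
        (∀ y, u x - φ x ≤ u y - φ y) ∧ q = gradient φ x }

def IsCellSubsolution {N : ℕ} (H : Euc N → Euc N → ℝ) (P : Euc N) (a : ℝ) (u : Euc N → ℝ) : Prop :=
  ∀ x, ∀ q ∈ superDiff u x, H x (q + P) ≤ a

def IsCellSupersolution {N : ℕ} (H : Euc N → Euc N → ℝ) (P : Euc N) (a : ℝ) (u : Euc N → ℝ) : Prop :=
  ∀ x, ∀ q ∈ subDiff u x, a ≤ H x (q + P)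

def IsCellSolution {N : ℕ} (H : Euc N → Euc N → ℝ) (P : Euc N) (u : Euc N → ℝ) (a : ℝ) : Prop :=
  (∃ K : NNReal, LipschitzWith K u) ∧ IsZPeriodic u ∧
    IsCellSubsolution H P a u ∧ IsCellSupersolution H P a u

def IsCoerciveH {N : ℕ} (H : Euc N → Euc N → ℝ) : Prop :=
  ∀ C : ℝ, ∃ r : ℝ, ∀ x p : Euc N, r ≤ ‖p‖ → C ≤ H x p

theorem abs_sub_sin_div_le {t : ℝ} (ht : |t| ≤ 1 / 2) :
    |t - Real.sin (2 * Real.pi * t) / (2 * Real.pi)| ≤ 16 * t ^ 2 := by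
  have hpi := Real.pi_pos
  have hpi4 := Real.pi_le_four
  have h : |t - Real.sin (2 * Real.pi * t) / (2 * Real.pi)| =
      |2 * Real.pi * t - Real.sin (2 * Real.pi * t)| / (2 * Real.pi) := by
    rw [← abs_of_pos (show 0 < 2 * Real.pi by positivity), ← abs_div,
      abs_of_pos (show 0 < 2 * Real.pi by positivity)]
    congr 1
    field_simp
  rw [h, div_le_iff₀ (by positivity)]
  calc |2 * Real.pi * t - Real.sin (2 * Real.pi * t)|
      ≤ |2 * Real.pi * t| ^ 3 / 6 := Real.abs_sub_sin_le _
    _ = t ^ 2 * (2 * Real.pi) * (Real.pi ^ 2 * (4 * |t|) / 6) := by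
        rw [abs_mul, abs_of_pos (show 0 < 2 * Real.pi by positivity), ← sq_abs t]; ring
    _ ≤ t ^ 2 * (2 * Real.pi) * 16 := by
        gcongr
        nlinarith [abs_nonneg t]
    _ = _ := by ring

theorem eight_mul_sq_le_one_sub_cos {t : ℝ} (ht : |t| ≤ 1 / 2) :
    8 * t ^ 2 ≤ 1 - Real.cos (2 * Real.pi * t) := by
  have hpi := Real.pi_pos
  have h := Real.cos_le_one_sub_mul_cos_sq (x := 2 * Real.pi * t) (by
    rw [abs_mul, abs_of_pos (by positivity)]; nlinarith)
  have h2 : 2 / Real.pi ^ 2 * (2 * Real.pi * t) ^ 2 = 8 * t ^ 2 := by field_simp; ring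
  linarith

variable {N : ℕ}

theorem intVec_apply (z : Fin N → ℤ) (i : Fin N) : intVec z i = z i := rfl

theorem intVec_neg (z : Fin N → ℤ) : intVec (-z) = -intVec z := by
  ext i; simp [intVec_apply]

/-- Every point has an integer translate in the centred unit cube. -/
theorem exists_intVec_abs_sub_le (x : Euc N) :
    ∃ z : Fin N → ℤ, ∀ i, |(x - intVec z) i| ≤ 1 / 2 := by
  refine ⟨fun i => round (x i), fun i => ?_⟩
  simpa [intVec_apply] using abs_sub_round (x i)

theorem norm_le_of_abs_le_half {x : Euc N} (h : ∀ i, |x i| ≤ 1 / 2) : ‖x‖ ≤ N := by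
  have h1 : ‖x‖ ^ 2 ≤ (N : ℝ) ^ 2 := by
    rw [EuclideanSpace.real_norm_sq_eq]
    calc ∑ i, x i ^ 2 ≤ ∑ _i : Fin N, (1 : ℝ) := by
          refine Finset.sum_le_sum fun i _ => ?_
          rw [← sq_abs]
          nlinarith [h i, abs_nonneg (x i)]
      _ = N := by simp
      _ ≤ (N : ℝ) ^ 2 := by exact_mod_cast Nat.le_self_pow two_ne_zero N
  exact le_of_sq_le_sq h1 (by positivity)

theorem exists_intVec_norm_sub_le (x : Euc N) : ∃ z : Fin N → ℤ, ‖x - intVec z‖ ≤ N := by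
  obtain ⟨z, hz⟩ := exists_intVec_abs_sub_le x
  exact ⟨z, norm_le_of_abs_le_half hz⟩

theorem IsZPeriodic.sub_intVec {u : Euc N → ℝ} (hu : IsZPeriodic u) (x : Euc N)
    (z : Fin N → ℤ) : u (x - intVec z) = u x := by
  rw [sub_eq_add_neg, ← intVec_neg, hu]

theorem IsZPeriodic.add {u v : Euc N → ℝ} (hu : IsZPeriodic u) (hv : IsZPeriodic v) :
    IsZPeriodic (fun x => u x + v x) := fun x z => by simp only [hu x z, hv x z]

theorem IsZPeriodic.sub {u v : Euc N → ℝ} (hu : IsZPeriodic u) (hv : IsZPeriodic v) :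
    IsZPeriodic (fun x => u x - v x) := fun x z => by simp only [hu x z, hv x z]

theorem IsZPeriodic.neg {u : Euc N → ℝ} (hu : IsZPeriodic u) :
    IsZPeriodic (fun x => -u x) := fun x z => by simp only [hu x z]

theorem isZPeriodic_const (c : ℝ) : IsZPeriodic (fun _ : Euc N => c) := fun _ _ => rfl

theorem IsZPeriodic.exists_forall_le {u : Euc N → ℝ} (hu : IsZPeriodic u)
    (hc : Continuous u) : ∃ x, ∀ y, u y ≤ u x := by
  obtain ⟨x, -, hx⟩ := (isCompact_closedBall (0 : Euc N) N).exists_isMaxOn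
    ⟨0, by simp⟩ hc.continuousOn
  refine ⟨x, fun y => ?_⟩
  obtain ⟨z, hz⟩ := exists_intVec_norm_sub_le y
  rw [← hu.sub_intVec y z]
  exact hx (by simpa using hz)

/-- A smooth periodic function vanishing exactly on the translates of `x`. -/
def cosPenalty (x y : Euc N) : ℝ := ∑ i, (1 - Real.cos (2 * Real.pi * (y i - x i)))

theorem cosPenalty_self (x : Euc N) : cosPenalty x x = 0 := by simp [cosPenalty]

theorem cosPenalty_nonneg (x y : Euc N) : 0 ≤ cosPenalty x y :=
  Finset.sum_nonneg fun i _ => by linarith [Real.cos_le_one (2 * Real.pi * (y i - x i))]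

theorem isZPeriodic_cosPenalty (x : Euc N) : IsZPeriodic (cosPenalty x) := by
  intro y z
  refine Finset.sum_congr rfl fun i _ => ?_
  have : 2 * Real.pi * ((y + intVec z) i - x i) =
      2 * Real.pi * (y i - x i) + z i * (2 * Real.pi) := by
    simp [intVec_apply]; ring
  rw [this, Real.cos_add_int_mul_two_pi]

theorem contDiff_cosPenalty (x : Euc N) : ContDiff ℝ 1 (cosPenalty x) := by
  unfold cosPenalty
  fun_prop

theorem gradient_cosPenalty_self (x : Euc N) : gradient (cosPenalty x) x = 0 := by
  have h : IsLocalMin (cosPenalty x) x := Eventually.of_forall fun y => by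
    rw [cosPenalty_self]; exact cosPenalty_nonneg x y
  simp [gradient, h.fderiv_eq_zero]

theorem eight_mul_norm_sq_le_cosPenalty {x y : Euc N} (h : ∀ i, |(y - x) i| ≤ 1 / 2) :
    8 * ‖y - x‖ ^ 2 ≤ cosPenalty x y := by
  rw [EuclideanSpace.real_norm_sq_eq, Finset.mul_sum]
  exact Finset.sum_le_sum fun i _ => eight_mul_sq_le_one_sub_cos (h i)

theorem exists_intVec_cosPenalty (x y : Euc N) :
    ∃ z : Fin N → ℤ, 8 * ‖y - intVec z - x‖ ^ 2 ≤ cosPenalty x y := by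
  obtain ⟨z, hz⟩ := exists_intVec_abs_sub_le (y - x)
  refine ⟨z, ?_⟩
  rw [← (isZPeriodic_cosPenalty x).sub_intVec y z]
  exact eight_mul_norm_sq_le_cosPenalty fun i => by rw [sub_right_comm]; exact hz i

/-- A smooth periodic function with gradient `a` at `x`. -/
def sinLinear (a x y : Euc N) : ℝ :=
  ∑ i, a i * (Real.sin (2 * Real.pi * (y i - x i)) / (2 * Real.pi))

theorem isZPeriodic_sinLinear (a x : Euc N) : IsZPeriodic (sinLinear a x) := by
  intro y z
  refine Finset.sum_congr rfl fun i _ => ?_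
  have : 2 * Real.pi * ((y + intVec z) i - x i) =
      2 * Real.pi * (y i - x i) + z i * (2 * Real.pi) := by
    simp [intVec_apply]; ring
  rw [this, Real.sin_add_int_mul_two_pi]

theorem contDiff_sinLinear (a x : Euc N) : ContDiff ℝ 1 (sinLinear a x) := by
  unfold sinLinear
  fun_prop

theorem gradient_sinLinear_self (a x : Euc N) : gradient (sinLinear a x) x = a := by
  refine HasGradientAt.gradient ?_
  rw [hasGradientAt_iff_hasFDerivAt]
  have h : ∀ i : Fin N, HasFDerivAt
      (fun y : Euc N => a i * (Real.sin (2 * Real.pi * (y i - x i)) / (2 * Real.pi)))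
      (a i • EuclideanSpace.proj (𝕜 := ℝ) i) x := by
    intro i
    have h1 : HasFDerivAt (fun y : Euc N => y i) (EuclideanSpace.proj (𝕜 := ℝ) i) x :=
      (EuclideanSpace.proj (𝕜 := ℝ) i).hasFDerivAt
    have h2 := ((((h1.sub_const (x i)).const_mul (2 * Real.pi)).sin).mul_const
      (2 * Real.pi)⁻¹).const_mul (a i)
    simp only [div_eq_mul_inv]
    refine h2.congr_fderiv ?_
    ext v
    simp
    left
    field_simp
  have h3 := HasFDerivAt.fun_sum (u := Finset.univ) fun i _ => h i
  refine h3.congr_fderiv ?_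
  ext v
  simp [PiLp.inner_apply, mul_comm]

theorem gradient_add_of_contDiff {f g : Euc N → ℝ} (hf : ContDiff ℝ 1 f)
    (hg : ContDiff ℝ 1 g) (x : Euc N) :
    gradient (fun y => f y + g y) x = gradient f x + gradient g x := by
  simp only [gradient]
  rw [fderiv_fun_add (hf.differentiable one_ne_zero x) (hg.differentiable one_ne_zero x), map_add]

theorem gradient_sub_of_contDiff {f g : Euc N → ℝ} (hf : ContDiff ℝ 1 f)
    (hg : ContDiff ℝ 1 g) (x : Euc N) :
    gradient (fun y => f y - g y) x = gradient f x - gradient g x := by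
  simp only [gradient]
  rw [fderiv_fun_sub (hf.differentiable one_ne_zero x) (hg.differentiable one_ne_zero x), map_sub]

theorem gradient_neg' (f : Euc N → ℝ) (x : Euc N) :
    gradient (fun y => -f y) x = -gradient f x := by
  simp only [gradient]
  rw [fderiv_fun_neg, map_neg]

theorem continuous_gradient_of_contDiff {f : Euc N → ℝ} (hf : ContDiff ℝ 1 f) :
    Continuous (gradient f) :=
  (InnerProductSpace.toDual ℝ (Euc N)).symm.continuous.comp (hf.continuous_fderiv one_ne_zero)

theorem IsZPeriodic.gradient_sub_intVec {f : Euc N → ℝ} (hf : IsZPeriodic f) (x : Euc N)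
    (z : Fin N → ℤ) : gradient f (x - intVec z) = gradient f x := by
  simp only [gradient]
  rw [sub_eq_add_neg, ← intVec_neg, ← fderiv_comp_add_right]
  simp only [hf _ (-z)]

/-- A one-sided quadratic expansion of a periodic function yields a superdifferential. -/
theorem mem_superDiff_of_le_quadratic {u : Euc N → ℝ} (hu : IsZPeriodic u) {a x : Euc N}
    {C : ℝ} (h : ∀ y, u y ≤ u x + inner ℝ a (y - x) + C * ‖y - x‖ ^ 2) :
    a ∈ superDiff u x := by
  set M : ℝ := (16 * ‖a‖ + |C|) / 8 with hM
  have hM0 : 0 ≤ M := by positivity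
  refine ⟨fun y => sinLinear a x y + M * cosPenalty x y,
    (contDiff_sinLinear a x).add (contDiff_const.mul (contDiff_cosPenalty x)),
    fun y z => by simp only [isZPeriodic_sinLinear a x y z, isZPeriodic_cosPenalty x y z],
    fun y => ?_, ?_⟩
  · have hper : IsZPeriodic (fun y => u y - (sinLinear a x y + M * cosPenalty x y)) :=
      fun y z => by
        simp only [hu y z, isZPeriodic_sinLinear a x y z, isZPeriodic_cosPenalty x y z]
    obtain ⟨z, hz⟩ := exists_intVec_abs_sub_le (y - x)
    have hz' : ∀ i, |(y - intVec z - x) i| ≤ 1 / 2 := fun i => by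
      rw [sub_right_comm]; exact hz i
    have hy := hper.sub_intVec y z
    rw [← hy]
    generalize y - intVec z = w at hz'
    have h1 := h w
    have h2 := eight_mul_norm_sq_le_cosPenalty hz'
    have h3 : inner ℝ a (w - x) - sinLinear a x w ≤ 16 * ‖a‖ * ‖w - x‖ ^ 2 := by
      rw [EuclideanSpace.real_norm_sq_eq, Finset.mul_sum, PiLp.inner_apply, sinLinear,
        ← Finset.sum_sub_distrib]
      refine Finset.sum_le_sum fun i _ => ?_
      have h4 := abs_sub_sin_div_le (hz' i)
      have h5 : |a i| ≤ ‖a‖ := PiLp.norm_apply_le a i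
      calc inner ℝ (a i) ((w - x) i) -
            a i * (Real.sin (2 * Real.pi * (w i - x i)) / (2 * Real.pi))
          = a i * ((w - x) i - Real.sin (2 * Real.pi * (w - x) i) / (2 * Real.pi)) := by
            simp; ring
        _ ≤ |a i| * |(w - x) i - Real.sin (2 * Real.pi * (w - x) i) / (2 * Real.pi)| := by
            rw [← abs_mul]; exact le_abs_self _
        _ ≤ ‖a‖ * (16 * (w - x) i ^ 2) := by gcongr
        _ = _ := by ring
    have h6 : C * ‖w - x‖ ^ 2 ≤ |C| * ‖w - x‖ ^ 2 := by
      gcongr; exact le_abs_self C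
    have h7 : (16 * ‖a‖ + |C|) * ‖w - x‖ ^ 2 ≤ M * cosPenalty x w := by
      calc _ = M * (8 * ‖w - x‖ ^ 2) := by rw [hM]; ring
        _ ≤ _ := by gcongr
    have h8 : sinLinear a x x = 0 := by simp [sinLinear]
    simp only [h8, cosPenalty_self]
    linarith
  · have h1 := gradient_add_of_contDiff (contDiff_sinLinear a x)
      (contDiff_const (c := M) |>.mul (contDiff_cosPenalty x)) x
    rw [h1, gradient_sinLinear_self]
    have h2 : IsLocalMin (fun y => M * cosPenalty x y) x := Eventually.of_forall fun y => by
      simpa only [cosPenalty_self, mul_zero] using mul_nonneg hM0 (cosPenalty_nonneg x y)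
    have h3 : gradient (fun y => M * cosPenalty x y) x = 0 := by
      simp only [gradient, h2.fderiv_eq_zero, map_zero]
    rw [h3, add_zero]

/-- A bound on the superdifferentials of a periodic function is a Lipschitz bound. -/
theorem le_add_mul_norm_of_superDiff_bounded {u : Euc N → ℝ} (hu : IsZPeriodic u)
    (hc : Continuous u) {K : ℝ} (hK : 0 ≤ K) (h : ∀ x, ∀ q ∈ superDiff u x, ‖q‖ ≤ K)
    (x y : Euc N) : u y ≤ u x + (K + 1) * ‖y - x‖ := by
  obtain ⟨m, hm⟩ := hu.exists_forall_le hc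
  have hL : 0 < K + 1 := by linarith
  have hfc : Continuous fun y => u y - (K + 1) * ‖y - x‖ := by fun_prop
  obtain ⟨w, hw⟩ := hfc.exists_forall_ge' x (by
    filter_upwards [(isCompact_closedBall x ((u m - u x) / (K + 1))).compl_mem_cocompact]
      with y hy
    have h1 : (u m - u x) / (K + 1) < ‖y - x‖ := by
      simpa [dist_eq_norm] using hy
    rw [div_lt_iff₀ hL] at h1
    simp only [sub_self, norm_zero, mul_zero, sub_zero]
    linarith [hm y])
  by_cases hwx : w = x
  · have := hw y
    simp only [hwx, sub_self, norm_zero, mul_zero, sub_zero] at this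
    linarith
  exfalso
  set r : ℝ := ‖w - x‖ with hr
  have hr0 : 0 < r := norm_pos_iff.mpr (sub_ne_zero.mpr hwx)
  have hmem : ((K + 1) / r) • (w - x) ∈ superDiff u w := by
    refine mem_superDiff_of_le_quadratic hu (C := (K + 1) / (2 * r)) fun y => ?_
    have h1 : ‖y - x‖ ^ 2 = ‖y - w‖ ^ 2 + 2 * inner ℝ (w - x) (y - w) + r ^ 2 := by
      rw [← sub_add_sub_cancel y w x, norm_add_sq_real, real_inner_comm]
    have h2 : ‖y - x‖ ≤ r + inner ℝ (w - x) (y - w) / r + ‖y - w‖ ^ 2 / (2 * r) := by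
      have h3 : r + inner ℝ (w - x) (y - w) / r + ‖y - w‖ ^ 2 / (2 * r) =
          (‖y - x‖ ^ 2 + r ^ 2) / (2 * r) := by
        rw [h1]; field_simp; ring
      rw [h3, le_div_iff₀ (by positivity)]
      nlinarith [sq_nonneg (‖y - x‖ - r)]
    have h4 := hw y
    have h5 := mul_le_mul_of_nonneg_left h2 hL.le
    rw [real_inner_smul_left]
    have h6 : (K + 1) * (r + inner ℝ (w - x) (y - w) / r + ‖y - w‖ ^ 2 / (2 * r)) =
        (K + 1) * r + (K + 1) / r * inner ℝ (w - x) (y - w) +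
          (K + 1) / (2 * r) * ‖y - w‖ ^ 2 := by ring
    linarith
  have h1 := h w _ hmem
  rw [norm_smul, Real.norm_of_nonneg (by positivity), ← hr, div_mul_cancel₀ _ hr0.ne'] at h1
  linarith

/-- Superdifferentials are stable under one-sided uniform perturbation. -/
theorem exists_superDiff_near {u φ : Euc N → ℝ} {x : Euc N} (hφ : ContDiff ℝ 1 φ)
    (hφp : IsZPeriodic φ) (hmax : ∀ y, u y - φ y ≤ u x - φ x) {η : ℝ} (hη : 0 < η) :
    ∃ ε > 0, ∀ v : Euc N → ℝ, Continuous v → IsZPeriodic v → (∀ y, v y ≤ u y + ε) →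
      u x - ε ≤ v x →
      ∃ y, ∃ q ∈ superDiff v y, dist y x < η ∧ dist q (gradient φ x) < η ∧ u x - η ≤ v y := by
  set θ : Euc N → ℝ := fun y => φ y + cosPenalty x y with hθ
  have hθc : ContDiff ℝ 1 θ := hφ.add (contDiff_cosPenalty x)
  have hθp : IsZPeriodic θ := hφp.add (isZPeriodic_cosPenalty x)
  have hθx : gradient θ x = gradient φ x := by
    rw [hθ, gradient_add_of_contDiff hφ (contDiff_cosPenalty x), gradient_cosPenalty_self,
      add_zero]
  obtain ⟨ρ₁, hρ₁, h₁⟩ :=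
    Metric.continuousAt_iff.mp (continuous_gradient_of_contDiff hθc).continuousAt η hη
  obtain ⟨ρ₂, hρ₂, h₂⟩ :=
    Metric.continuousAt_iff.mp (hφ.continuous.continuousAt (x := x)) (η / 2) (by positivity)
  rw [hθx] at h₁
  set ρ := min η (min ρ₁ ρ₂) with hρ
  have hρ0 : 0 < ρ := by positivity
  refine ⟨min (η / 2) (ρ ^ 2), by positivity, fun v hvc hvp hvu hvx => ?_⟩
  set ε := min (η / 2) (ρ ^ 2)
  have hε₁ : ε ≤ η / 2 := min_le_left _ _
  have hε₂ : ε ≤ ρ ^ 2 := min_le_right _ _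
  obtain ⟨y₀, hy₀⟩ := (hvp.sub hθp).exists_forall_le (hvc.sub hθc.continuous)
  obtain ⟨z, hz⟩ := exists_intVec_cosPenalty x y₀
  rw [← (isZPeriodic_cosPenalty x).sub_intVec y₀ z] at hz
  have hy : ∀ y, v y - θ y ≤ v (y₀ - intVec z) - θ (y₀ - intVec z) := fun y => by
    rw [hvp.sub_intVec, hθp.sub_intVec]; exact hy₀ y
  generalize y₀ - intVec z = w at hz hy
  have hwx := hy x
  simp only [hθ, cosPenalty_self] at hwx
  have hw : cosPenalty x w ≤ 2 * ε := by linarith [hvu w, hmax w]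
  have hdist : dist w x < ρ := by
    rw [dist_eq_norm]
    refine lt_of_pow_lt_pow_left₀ 2 hρ0.le ?_
    have : 0 < ρ ^ 2 := by positivity
    linarith
  refine ⟨w, gradient θ w, ⟨θ, hθc, hθp, hy, rfl⟩, hdist.trans_le (min_le_left _ _),
    h₁ (hdist.trans_le ((min_le_right _ _).trans (min_le_left _ _))), ?_⟩
  have h3 := h₂ (hdist.trans_le ((min_le_right _ _).trans (min_le_right _ _)))
  rw [Real.dist_eq, abs_lt] at h3
  linarith [cosPenalty_nonneg x w]

theorem superDiff_const (c : ℝ) (x q : Euc N) (hq : q ∈ superDiff (fun _ => c) x) : q = 0 := by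
  obtain ⟨φ, -, -, hmax, rfl⟩ := hq
  have h : IsLocalMin φ x := Eventually.of_forall fun y => by linarith [hmax y]
  simp [gradient, h.fderiv_eq_zero]

theorem zero_mem_superDiff {u : Euc N → ℝ} {x : Euc N} (h : ∀ y, u y ≤ u x) :
    0 ∈ superDiff u x :=
  ⟨fun _ => 0, contDiff_const, isZPeriodic_const 0, by simpa using h, by simp⟩

theorem neg_mem_superDiff_neg {u : Euc N → ℝ} {x q : Euc N} :
    -q ∈ superDiff (fun y => -u y) x ↔ q ∈ subDiff u x := by
  constructor
  · rintro ⟨φ, hφ, hφp, hmax, hq⟩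
    refine ⟨fun y => -φ y, hφ.neg, hφp.neg, fun y => by linarith [hmax y], ?_⟩
    rw [gradient_neg', ← hq, neg_neg]
  · rintro ⟨φ, hφ, hφp, hmin, rfl⟩
    exact ⟨fun y => -φ y, hφ.neg, hφp.neg, fun y => by linarith [hmin y],
      (gradient_neg' φ x).symm⟩

theorem superDiff_add_const {u : Euc N → ℝ} {c : ℝ} {x : Euc N} :
    superDiff (fun y => u y + c) x = superDiff u x := by
  ext q
  constructor <;> rintro ⟨φ, hφ, hφp, hmax, hq⟩ <;>
    exact ⟨φ, hφ, hφp, fun y => by linarith [hmax y], hq⟩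

/-- Continuous periodic viscosity subsolutions of `lam * v + G (x, Dv) = 0`. -/
structure IsDiscountedSubsolution (G : Euc N → Euc N → ℝ) (lam : ℝ) (v : Euc N → ℝ) : Prop where
  continuous : Continuous v
  periodic : IsZPeriodic v
  le_zero : ∀ x, ∀ q ∈ superDiff v x, lam * v x + G x q ≤ 0

theorem IsDiscountedSubsolution.mul_le {G : Euc N → Euc N → ℝ} {lam C : ℝ} {v : Euc N → ℝ}
    (hv : IsDiscountedSubsolution G lam v) (hlam : 0 < lam) (hC : ∀ x, -C ≤ G x 0) (x : Euc N) :
    lam * v x ≤ C := by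
  obtain ⟨m, hm⟩ := hv.periodic.exists_forall_le hv.continuous
  have h1 := hv.le_zero m 0 (zero_mem_superDiff hm)
  have h2 := mul_le_mul_of_nonneg_left (hm x) hlam.le
  linarith [hC m]

/-- The pointwise supremum of an equi-Lipschitz family of subsolutions is a subsolution. -/
theorem isDiscountedSubsolution_iSup {ι : Type*} [Nonempty ι] {G : Euc N → Euc N → ℝ}
    (hG : Continuous fun q : Euc N × Euc N => G q.1 q.2) {lam L : ℝ} (hlam : 0 < lam)
    {v : ι → Euc N → ℝ} (hv : ∀ i, IsDiscountedSubsolution G lam (v i))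
    (hbdd : ∀ x, BddAbove (range fun i => v i x))
    (hlip : ∀ i x y, v i y ≤ v i x + L * ‖y - x‖) :
    IsDiscountedSubsolution G lam (fun x => ⨆ i, v i x) := by
  have hle : ∀ i x, v i x ≤ ⨆ i, v i x := fun i x => le_ciSup (hbdd x) i
  refine ⟨?_, fun x z => by simp only [(hv _).periodic x z], ?_⟩
  · refine (LipschitzWith.of_le_add_mul' L fun y x => ciSup_le fun i => ?_).continuous
    rw [dist_eq_norm]
    linarith [hlip i x y, hle i x]
  · rintro x _ ⟨φ, hφ, hφp, hmax, rfl⟩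
    by_contra! hpos
    set U : ℝ := ⨆ i, v i x with hU
    set c := lam * U + G x (gradient φ x) with hc
    obtain ⟨η, hη, h⟩ := Metric.continuousAt_iff.mp
      (hG.continuousAt (x := (x, gradient φ x))) (c / 2) (by positivity)
    obtain ⟨ε, hε, h'⟩ := exists_superDiff_near hφ hφp hmax
      (η := min η (c / (2 * lam))) (by positivity)
    obtain ⟨i, hi⟩ := exists_lt_of_lt_ciSup (show U - ε < ⨆ i, v i x by linarith)
    obtain ⟨y, q, hq, hy, hqd, hvy⟩ := h' (v i) (hv i).continuous (hv i).periodic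
      (fun y => by linarith [hle i y]) hi.le
    have h1 := (hv i).le_zero y q hq
    have h2 := h (x := (y, q)) (by
      rw [Prod.dist_eq]
      exact max_lt (hy.trans_le (min_le_left _ _)) (hqd.trans_le (min_le_left _ _)))
    rw [Real.dist_eq, abs_lt] at h2
    have h3 : U - c / (2 * lam) ≤ v i y := by linarith [min_le_right η (c / (2 * lam))]
    have h4 : lam * U - c / 2 ≤ lam * v i y := by
      calc lam * U - c / 2 = lam * (U - c / (2 * lam)) := by field_simp
        _ ≤ _ := by gcongr
    simp only at h2
    linarith

/-- Perron's bump: a subsolution failing the supersolution test is not maximal. -/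
theorem IsDiscountedSubsolution.exists_bump {G : Euc N → Euc N → ℝ}
    (hG : Continuous fun q : Euc N × Euc N => G q.1 q.2) (hGp : IsZPeriodicH G) {lam : ℝ}
    (hlam : 0 < lam) {u : Euc N → ℝ} (hu : IsDiscountedSubsolution G lam u) {x q : Euc N}
    (hq : q ∈ subDiff u x) (hneg : lam * u x + G x q < 0) :
    ∃ w, IsDiscountedSubsolution G lam w ∧ (∀ y, u y ≤ w y) ∧ u x < w x := by
  obtain ⟨φ, hφ, hφp, hmin, rfl⟩ := hq
  set g : Euc N → ℝ := fun y => φ y + (u x - φ x) - cosPenalty x y with hg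
  have hφ' : ContDiff ℝ 1 fun y => φ y + (u x - φ x) := hφ.add contDiff_const
  have hgc : ContDiff ℝ 1 g := hφ'.sub (contDiff_cosPenalty x)
  have hgp : IsZPeriodic g :=
    (hφp.add (isZPeriodic_const _)).sub (isZPeriodic_cosPenalty x)
  have hgx : g x = u x := by simp [hg, cosPenalty_self]
  have hgrad : gradient g x = gradient φ x := by
    rw [hg, gradient_sub_of_contDiff hφ' (contDiff_cosPenalty x), gradient_cosPenalty_self,
      gradient_add_of_contDiff hφ contDiff_const]
    simp
  set c := -(lam * u x + G x (gradient φ x)) with hc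
  have hc0 : 0 < c := by linarith
  have hcont : Continuous fun y => lam * g y + G y (gradient g y) :=
    (continuous_const.mul hgc.continuous).add
      (hG.comp (continuous_id.prodMk (continuous_gradient_of_contDiff hgc)))
  obtain ⟨ρ, hρ, h⟩ := Metric.continuousAt_iff.mp (hcont.continuousAt (x := x)) (c / 2)
    (by positivity)
  simp only [hgx, hgrad] at h
  set δ := min (c / (2 * lam)) (ρ ^ 2) with hδ
  have hδ0 : 0 < δ := by positivity
  have hlδ : lam * δ ≤ c / 2 := by
    calc lam * δ ≤ lam * (c / (2 * lam)) := by gcongr; exact min_le_left _ _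
      _ = c / 2 := by field_simp
  have hstrict : ∀ y, cosPenalty x y ≤ δ → lam * (g y + δ) + G y (gradient g y) ≤ 0 := by
    intro y hy
    obtain ⟨z, hz⟩ := exists_intVec_cosPenalty x y
    have hd : dist (y - intVec z) x < ρ := by
      rw [dist_eq_norm]
      refine lt_of_pow_lt_pow_left₀ 2 hρ.le ?_
      have h1 : 0 < ρ ^ 2 := by positivity
      have h2 : δ ≤ ρ ^ 2 := min_le_right _ _
      linarith
    have h1 := h hd
    have h2 : G (y - intVec z) (gradient g y) = G y (gradient g y) := by
      rw [sub_eq_add_neg, ← intVec_neg, hGp]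
    rw [hgp.sub_intVec, hgp.gradient_sub_intVec, h2, Real.dist_eq, abs_lt] at h1
    linarith
  refine ⟨fun y => max (u y) (g y + δ), ⟨hu.continuous.max (hgc.continuous.add_const δ),
    fun y z => by simp only [hu.periodic y z, hgp y z], ?_⟩, fun y => le_max_left _ _,
    lt_max_of_lt_right (by linarith)⟩
  rintro y _ ⟨θ, hθ, hθp, hmax, rfl⟩
  rcases le_or_gt (g y + δ) (u y) with hy | hy
  · simp only [max_eq_left hy] at hmax ⊢
    exact hu.le_zero y _ ⟨θ, hθ, hθp, fun w => by linarith [hmax w, le_max_left (u w) (g w + δ)],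
      rfl⟩
  · simp only [max_eq_right hy.le] at hmax ⊢
    have h1 : IsLocalMax (fun w => g w - θ w) y := Eventually.of_forall fun w => by
      linarith [hmax w, le_max_right (u w) (g w + δ)]
    have h2 : gradient (fun w => g w - θ w) y = 0 := by
      simp only [gradient, h1.fderiv_eq_zero, map_zero]
    rw [gradient_sub_of_contDiff hgc hθ, sub_eq_zero] at h2
    rw [← h2]
    refine hstrict y ?_
    simp only [hg] at hy
    linarith [hmin y]

/-- Perron's method for the discounted equation, with bounds independent of the discount. -/
theorem exists_discounted_solution {G : Euc N → Euc N → ℝ}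
    (hG : Continuous fun q : Euc N × Euc N => G q.1 q.2) (hGp : IsZPeriodicH G)
    (hGcoer : IsCoerciveH G) :
    ∃ K C : ℝ, 0 ≤ K ∧ ∀ lam : ℝ, 0 < lam → ∃ u : Euc N → ℝ,
      IsDiscountedSubsolution G lam u ∧ (∀ x, ∀ q ∈ subDiff u x, 0 ≤ lam * u x + G x q) ∧
      (∀ x y, u y ≤ u x + K * ‖y - x‖) ∧ ∀ x, |lam * u x| ≤ C := by
  have hG0 : Continuous fun x => G x 0 := hG.comp (continuous_id.prodMk continuous_const)
  have hG0p : IsZPeriodic fun x => G x 0 := fun x z => hGp x 0 z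
  obtain ⟨m, hm⟩ := hG0p.exists_forall_le hG0
  obtain ⟨m', hm'⟩ := hG0p.neg.exists_forall_le hG0.neg
  set C := max (G m 0) (-G m' 0) with hC
  have hCu : ∀ x, G x 0 ≤ C := fun x => (hm x).trans (le_max_left _ _)
  have hCl : ∀ x, -C ≤ G x 0 := fun x => by
    linarith [hm' x, le_max_right (G m 0) (-G m' 0)]
  obtain ⟨r, hr⟩ := hGcoer (C + 1)
  refine ⟨max r 0 + 1, C, by positivity, fun lam hlam => ?_⟩
  have hconst : lam * (-C / lam) = -C := by field_simp
  let F := {v : Euc N → ℝ // IsDiscountedSubsolution G lam v ∧ ∀ x, -C / lam ≤ v x}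
  have hlip : ∀ (v : F) (x y), v.1 y ≤ v.1 x + (max r 0 + 1) * ‖y - x‖ := by
    rintro ⟨v, hv, hvl⟩ x y
    refine le_add_mul_norm_of_superDiff_bounded hv.periodic hv.continuous (le_max_right _ _)
      (fun x q hq => ?_) x y
    by_contra! hlt
    have h1 := hr x q ((le_max_left _ _).trans hlt.le)
    have h2 := hv.le_zero x q hq
    have h3 := mul_le_mul_of_nonneg_left (hvl x) hlam.le
    linarith
  have : Nonempty F := ⟨⟨fun _ => -C / lam, ⟨continuous_const, isZPeriodic_const _,
    fun x q hq => by
      rw [superDiff_const _ x q hq, hconst]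
      linarith [hCu x]⟩, fun _ => le_rfl⟩⟩
  have hbdd : ∀ x, BddAbove (range fun v : F => v.1 x) := fun x => by
    refine ⟨C / lam, ?_⟩
    rintro _ ⟨v, rfl⟩
    rw [le_div_iff₀ hlam, mul_comm]
    exact v.2.1.mul_le hlam hCl x
  have hle : ∀ (v : F) x, v.1 x ≤ ⨆ v : F, v.1 x := fun v x => le_ciSup (hbdd x) v
  have hsub : IsDiscountedSubsolution G lam fun x => ⨆ v : F, v.1 x :=
    isDiscountedSubsolution_iSup hG hlam (fun v => v.2.1) hbdd hlip
  have hlow : ∀ x, -C / lam ≤ ⨆ v : F, v.1 x := fun x =>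
    ((Classical.arbitrary F).2.2 x).trans (hle _ x)
  refine ⟨_, hsub, fun x q hq => ?_, fun x y => ciSup_le fun v => ?_, fun x => abs_le.mpr ⟨?_, ?_⟩⟩
  · by_contra! hneg
    obtain ⟨w, hw, huw, hlt⟩ := hsub.exists_bump hG hGp hlam hq hneg
    exact hlt.not_ge (hle ⟨w, hw, fun y => (hlow y).trans (huw y)⟩ x)
  · linarith [hlip v x y, hle v x]
  · exact hconst.symm.le.trans (mul_le_mul_of_nonneg_left (hlow x) hlam.le)
  · exact hsub.mul_le hlam hCl x

/-- Stability of viscosity subsolutions under uniform convergence. -/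
theorem le_of_superDiff_of_uniform_limit {G : Euc N → Euc N → ℝ}
    (hG : Continuous fun q : Euc N × Euc N => G q.1 q.2) {l : Filter ℕ} [l.NeBot]
    {w : ℕ → Euc N → ℝ} {W : Euc N → ℝ} {a : ℝ} (hwc : ∀ n, Continuous (w n))
    (hwp : ∀ n, IsZPeriodic (w n))
    (hunif : ∀ ε > 0, ∀ᶠ n in l, ∀ y, |w n y - W y| ≤ ε)
    (hw : ∀ x, ∀ η > 0, ∀ᶠ n in l, ∀ y, dist y x < 1 → ∀ q ∈ superDiff (w n) y, G y q ≤ a + η)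
    (x q : Euc N) (hq : q ∈ superDiff W x) : G x q ≤ a := by
  obtain ⟨φ, hφ, hφp, hmax, rfl⟩ := hq
  by_contra! hlt
  set c := G x (gradient φ x) - a with hc
  have hc0 : 0 < c := by linarith
  obtain ⟨η, hη, h⟩ := Metric.continuousAt_iff.mp
    (hG.continuousAt (x := (x, gradient φ x))) (c / 2) (by positivity)
  obtain ⟨ε, hε, h'⟩ := exists_superDiff_near hφ hφp hmax (η := min η 1) (by positivity)
  obtain ⟨n, hn₁, hn₂⟩ := ((hunif ε hε).and (hw x (c / 2) (by positivity))).exists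
  obtain ⟨y, q, hq, hy, hqd, -⟩ := h' (w n) (hwc n) (hwp n)
    (fun y => by linarith [(abs_le.mp (hn₁ y)).2]) (by linarith [(abs_le.mp (hn₁ x)).1])
  have h1 := hn₂ y (hy.trans_le (min_le_right _ _)) q hq
  have h2 := h (x := (y, q)) (by
    rw [Prod.dist_eq]
    exact max_lt (hy.trans_le (min_le_left _ _)) (hqd.trans_le (min_le_left _ _)))
  rw [Real.dist_eq, abs_lt] at h2
  simp only at h2
  linarith

theorem Ultrafilter.exists_tendsto_of_abs_le {ι : Type*} (U : Ultrafilter ι) {f : ι → ℝ} {B : ℝ}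
    (h : ∀ i, |f i| ≤ B) : ∃ a, Tendsto f U (nhds a) := by
  obtain ⟨a, -, ha⟩ := (isCompact_Icc (a := -B) (b := B)).ultrafilter_le_nhds (U.map f)
    (tendsto_principal.mpr (Eventually.of_forall fun i => abs_le.mp (h i)))
  exact ⟨a, ha⟩

/-- Pointwise convergence of equi-Lipschitz periodic functions is uniform. -/
theorem eventually_forall_abs_sub_le_of_lipschitz {l : Filter ℕ} {w : ℕ → Euc N → ℝ}
    {W : Euc N → ℝ} {K : ℝ} (hK : 0 ≤ K) (hwp : ∀ n, IsZPeriodic (w n)) (hWp : IsZPeriodic W)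
    (hw : ∀ n x y, w n y ≤ w n x + K * ‖y - x‖) (hW : ∀ x y, W y ≤ W x + K * ‖y - x‖)
    (hlim : ∀ x, Tendsto (fun n => w n x) l (nhds (W x))) {ε : ℝ} (hε : 0 < ε) :
    ∀ᶠ n in l, ∀ y, |w n y - W y| ≤ ε := by
  obtain ⟨t, -, ht, hcover⟩ := (isCompact_closedBall (0 : Euc N) N).finite_cover_balls
    (e := ε / (3 * (K + 1))) (by positivity)
  have hev : ∀ᶠ n in l, ∀ c ∈ t, |w n c - W c| < ε / 3 := by
    refine (eventually_all_finite ht).mpr fun c _ => ?_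
    have := Metric.tendsto_nhds.mp (hlim c) (ε / 3) (by positivity)
    simpa only [Real.dist_eq] using this
  filter_upwards [hev] with n hn y
  obtain ⟨z, hz⟩ := exists_intVec_norm_sub_le y
  rw [← (hwp n).sub_intVec y z, ← hWp.sub_intVec y z]
  generalize y - intVec z = y at hz
  obtain ⟨c, hc, hyc⟩ := mem_iUnion₂.mp (hcover (by simpa using hz : y ∈ _))
  rw [Metric.mem_ball, dist_eq_norm] at hyc
  have h1 : K * ‖y - c‖ ≤ ε / 3 := by
    calc K * ‖y - c‖ ≤ (K + 1) * (ε / (3 * (K + 1))) := by gcongr; linarith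
      _ = ε / 3 := by field_simp
  have h2 := abs_lt.mp (hn c hc)
  have h3 := norm_sub_rev y c
  have h4 := hw n c y
  have h5 := hw n y c
  have h6 := hW c y
  have h7 := hW y c
  rw [← h3] at h5 h7
  exact abs_le.mpr ⟨by linarith, by linarith⟩

/-- Ergodic limit of the discounted problems. -/
theorem exists_ergodic_solution {G : Euc N → Euc N → ℝ}
    (hG : Continuous fun q : Euc N × Euc N => G q.1 q.2) (hGp : IsZPeriodicH G)
    (hGcoer : IsCoerciveH G) :
    ∃ (W : Euc N → ℝ) (a K : ℝ), (∀ x y, W y ≤ W x + K * ‖y - x‖) ∧ IsZPeriodic W ∧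
      (∀ x, ∀ q ∈ superDiff W x, G x q ≤ a) ∧ ∀ x, ∀ q ∈ subDiff W x, a ≤ G x q := by
  obtain ⟨K, C, hK, hsol⟩ := exists_discounted_solution hG hGp hGcoer
  choose u hsub hsup hlip hbd using fun n : ℕ => hsol (1 / ((n : ℝ) + 1)) (by positivity)
  set lam : ℕ → ℝ := fun n => 1 / ((n : ℝ) + 1) with hlam
  have hlam0 : ∀ n, 0 < lam n := fun n => by positivity
  set w : ℕ → Euc N → ℝ := fun n x => u n x + -u n 0 with hw
  have hwlip : ∀ n x y, w n y ≤ w n x + K * ‖y - x‖ := fun n x y => by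
    simp only [hw]; linarith [hlip n x y]
  have hwabs : ∀ n x, |w n x| ≤ K * ‖x‖ := fun n x => by
    have h1 := hlip n 0 x
    have h2 := hlip n x 0
    rw [zero_sub, norm_neg] at h2
    rw [sub_zero] at h1
    exact abs_le.mpr ⟨by simp only [hw]; linarith, by simp only [hw]; linarith⟩
  have hwp : ∀ n, IsZPeriodic (w n) := fun n => (hsub n).periodic.add (isZPeriodic_const _)
  have hwc : ∀ n, Continuous (w n) := fun n => (hsub n).continuous.add continuous_const
  let U : Ultrafilter ℕ := hyperfilter ℕ
  choose W hW using fun x => U.exists_tendsto_of_abs_le fun n => hwabs n x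
  obtain ⟨b, hb⟩ := U.exists_tendsto_of_abs_le fun n => hbd n 0
  have hWlip : ∀ x y, W y ≤ W x + K * ‖y - x‖ := fun x y =>
    le_of_tendsto_of_tendsto' (hW y) ((hW x).add_const _) fun n => hwlip n x y
  have hWp : IsZPeriodic W := fun x z =>
    tendsto_nhds_unique (hW _) (by simpa only [hwp _ x z] using hW x)
  have hunif : ∀ ε > 0, ∀ᶠ n in (U : Filter ℕ), ∀ y, |w n y - W y| ≤ ε := fun ε hε =>
    eventually_forall_abs_sub_le_of_lipschitz hK hwp hWp hwlip hWlip hW hε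
  have hlamU : Tendsto lam U (nhds 0) :=
    tendsto_one_div_add_atTop_nhds_zero_nat.mono_left (Nat.hyperfilter_le_atTop)
  have hval : ∀ x, ∀ η > 0, ∀ᶠ n in (U : Filter ℕ), ∀ y, dist y x < 1 →
      |lam n * u n y - b| ≤ η := by
    intro x η hη
    have h1 : Tendsto (fun n => lam n * (K * (‖x‖ + 1))) U (nhds 0) := by
      simpa using hlamU.mul_const (K * (‖x‖ + 1))
    filter_upwards [h1.eventually_lt_const (half_pos hη),
      Metric.tendsto_nhds.mp hb (η / 2) (half_pos hη)] with n hn₁ hn₂ y hy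
    have h2 : ‖y‖ ≤ ‖x‖ + 1 := by
      rw [dist_eq_norm] at hy
      linarith [norm_sub_norm_le y x]
    have h3 : |lam n * w n y| ≤ lam n * (K * (‖x‖ + 1)) := by
      rw [abs_mul, abs_of_pos (hlam0 n)]
      exact mul_le_mul_of_nonneg_left ((hwabs n y).trans (by gcongr)) (hlam0 n).le
    have h4 : lam n * u n y - b = lam n * w n y + (lam n * u n 0 - b) := by
      simp only [hw]; ring
    rw [Real.dist_eq] at hn₂
    rw [h4]
    linarith [abs_add_le (lam n * w n y) (lam n * u n 0 - b)]
  refine ⟨W, -b, K, hWlip, hWp, ?_, fun x q hq => ?_⟩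
  · refine le_of_superDiff_of_uniform_limit hG hwc hwp hunif fun x η hη => ?_
    filter_upwards [hval x η hη] with n hn y hy q hq
    rw [superDiff_add_const] at hq
    linarith [(hsub n).le_zero y q hq, (abs_le.mp (hn y hy)).1]
  · have hG' : Continuous fun q : Euc N × Euc N => -G q.1 (-q.2) :=
      (hG.comp (continuous_fst.prodMk continuous_snd.neg)).neg
    have h := le_of_superDiff_of_uniform_limit (G := fun x q => -G x (-q)) (a := b) hG'
      (w := fun n y => -w n y) (W := fun y => -W y) (l := U)
      (fun n => (hwc n).neg) (fun n => (hwp n).neg)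
      (fun ε hε => ?_) (fun x η hη => ?_) x (-q) (neg_mem_superDiff_neg.mpr hq)
    · simp only [neg_neg] at h
      linarith
    · filter_upwards [hunif ε hε] with n hn y
      rw [← neg_sub', abs_neg]
      exact hn y
    · filter_upwards [hval x η hη] with n hn y hy q hq
      have h1 : (fun y => -w n y) = fun y => -u n y + u n 0 := by
        funext y; simp only [hw]; ring
      rw [h1, superDiff_add_const, ← neg_neg q, neg_mem_superDiff_neg] at hq
      linarith [hsup n y _ hq, (abs_le.mp (hn y hy)).2]

/-- Full solvability of the cell problem under coercivity
(Lions–Papanicolaou–Varadhan). -/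
theorem cell_problem_fully_solvable_of_coercive {N : ℕ} (hN : 1 ≤ N)
    (H : Euc N → Euc N → ℝ)
    (hHc : Continuous fun q : Euc N × Euc N => H q.1 q.2)
    (hHp : IsZPeriodicH H)
    (hHcoer : IsCoerciveH H) :
    ∀ P : Euc N, ∃ (u : Euc N → ℝ) (a : ℝ), IsCellSolution H P u a := by
  intro P
  obtain ⟨W, a, K, hlip, hper, hsub, hsup⟩ :=
    exists_ergodic_solution (G := fun x q => H x (q + P))
      (hHc.comp (continuous_fst.prodMk (continuous_snd.add_const P)))
      (fun x p z => hHp x (p + P) z) fun C => by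
        obtain ⟨r, hr⟩ := hHcoer C
        refine ⟨r + ‖P‖, fun x p hp => hr x (p + P) ?_⟩
        linarith [norm_sub_le (p + P) P, congrArg norm (add_sub_cancel_right p P)]
  exact ⟨W, a, ⟨K.toNNReal, LipschitzWith.of_le_add_mul' K fun x y => by
    rw [dist_eq_norm]; exact hlip y x⟩, hper, hsub, hsup⟩
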